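/- For all A, B ∈ Ã₁, the doubly contracted tensor product A : B is well defined, belongs to Ã₁, and satisfies ‖A : B‖_Ã₁ ≤ ‖A‖_Ã₁ ‖B‖_Ã₁. -/

import Mathlib

open scoped ComplexConjugate

noncomputable section

namespace PaperTensor

variable {I I₁ I₂ : Type*}

/-- The space `ℓ²(I)`. -/
abbrev L2 (I : Type*) := lp (fun _ : I => ℂ) 2

/-- The continuous linear map `T` represents the matrix `M` as an operator on `ℓ²(I)`,
i.e. `(T c) k = Σ_l M k l * c l` for every `c ∈ ℓ²(I)`. -/
def Represents (M : I → I → ℂ) (T : L2 I →L[ℂ] L2 I) : Prop :=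
  ∀ c : L2 I, ∀ k : I, HasSum (fun l : I => M k l * (c : ∀ _ : I, ℂ) l) ((T c : ∀ _ : I, ℂ) k)

/-- `M` defines a bounded operator on `ℓ²(I)`. -/
def Bounded2 (M : I → I → ℂ) : Prop := ∃ T : L2 I →L[ℂ] L2 I, Represents M T

/-- The operator norm `‖M‖_{B(ℓ²(I))}` of the matrix `M` (junk value `0` if `M` is unbounded). -/
noncomputable def opNorm2 (M : I → I → ℂ) : ℝ :=
  letI : Decidable (Bounded2 M) := Classical.propDecidable _
  if h : Bounded2 M then ‖h.choose‖ else 0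

/-- The matrix product of two infinite matrices. -/
noncomputable def matMul (A B : I → I → ℂ) : I → I → ℂ :=
  fun i j => ∑' m : I, A i m * B m j

/-- The conjugate transpose of a matrix. -/
def conjTranspose (A : I → I → ℂ) : I → I → ℂ := fun i j => conj (A j i)

/-- A solid Banach algebra of (infinite) matrices over the index set `I`. -/
structure SolidBanachAlgebra (I : Type*) where
  carrier : Set (I → I → ℂ)
  anorm : (I → I → ℂ) → ℝ
  zero_mem : (0 : I → I → ℂ) ∈ carrier
  add_mem : ∀ A B : I → I → ℂ, A ∈ carrier → B ∈ carrier → A + B ∈ carrier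
  smul_mem : ∀ (c : ℂ) (A : I → I → ℂ), A ∈ carrier → c • A ∈ carrier
  mul_mem : ∀ A B : I → I → ℂ, A ∈ carrier → B ∈ carrier → matMul A B ∈ carrier
  anorm_nonneg : ∀ A ∈ carrier, 0 ≤ anorm A
  anorm_zero : anorm 0 = 0
  anorm_eq_zero : ∀ A ∈ carrier, anorm A = 0 → A = 0
  anorm_smul : ∀ (c : ℂ), ∀ A ∈ carrier, anorm (c • A) = ‖c‖ * anorm A
  anorm_add : ∀ A ∈ carrier, ∀ B ∈ carrier, anorm (A + B) ≤ anorm A + anorm B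
  anorm_mul : ∀ A ∈ carrier, ∀ B ∈ carrier, anorm (matMul A B) ≤ anorm A * anorm B
  complete : ∀ f : ℕ → (I → I → ℂ), (∀ n, f n ∈ carrier) →
      (∀ ε > (0 : ℝ), ∃ N : ℕ, ∀ m ≥ N, ∀ n ≥ N, anorm (f m - f n) < ε) →
      ∃ A ∈ carrier, ∀ ε > (0 : ℝ), ∃ N : ℕ, ∀ n ≥ N, anorm (f n - A) < ε
  bounded : ∀ A ∈ carrier, Bounded2 A
  solid : ∀ A ∈ carrier, ∀ B : I → I → ℂ,
      (∀ i j, ‖B i j‖ ≤ ‖A i j‖) → B ∈ carrier ∧ anorm B ≤ anorm A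

/-- A matrix algebra is involutive if it is closed under conjugate transposition and the
norm is invariant under it. -/
def SolidBanachAlgebra.Involutive (𝒜 : SolidBanachAlgebra I) : Prop :=
  ∀ A ∈ 𝒜.carrier, conjTranspose A ∈ 𝒜.carrier ∧ 𝒜.anorm (conjTranspose A) = 𝒜.anorm A

/-- Rank-four tensors `(A_{i,k,l,j})` indexed by `I₁ × I₂² × I₁`. -/
abbrev Tensor (I₁ I₂ : Type*) := I₁ → I₂ → I₂ → I₁ → ℂ

/-- The restriction `A|_{{i} × I₂² × {j}}`, an `I₂ × I₂` matrix. -/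
def res1 (A : Tensor I₁ I₂) (i j : I₁) : I₂ → I₂ → ℂ := fun k l => A i k l j

/-- The restriction `A|_{I₁ × {(k,l)} × I₁}`, an `I₁ × I₁` matrix. -/
def res2 (A : Tensor I₁ I₂) (k l : I₂) : I₁ → I₁ → ℂ := fun i j => A i k l j

/-- Membership in `Ã₁`, for a set `S` of `I₁ × I₁` matrices playing the role of `𝒜₁`:
all restrictions `A|_{{i} × I₂² × {j}}` are bounded on `ℓ²(I₂)` and the matrix of their
operator norms belongs to `S`. -/
def MemT1 (S : Set (I₁ → I₁ → ℂ)) (A : Tensor I₁ I₂) : Prop :=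
  (∀ i j : I₁, Bounded2 (res1 A i j)) ∧
    (fun i j : I₁ => (opNorm2 (res1 A i j) : ℂ)) ∈ S

/-- Membership in `Ã₂`. -/
def MemT2 (S : Set (I₂ → I₂ → ℂ)) (A : Tensor I₁ I₂) : Prop :=
  (∀ k l : I₂, Bounded2 (res2 A k l)) ∧
    (fun k l : I₂ => (opNorm2 (res2 A k l) : ℂ)) ∈ S

/-- The norm `‖A‖_{Ã₁}` (meaningful on members of `Ã₁`). -/
noncomputable def normT1 (𝒜₁ : SolidBanachAlgebra I₁) (A : Tensor I₁ I₂) : ℝ :=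
  𝒜₁.anorm (fun i j : I₁ => (opNorm2 (res1 A i j) : ℂ))

/-- The norm `‖A‖_{Ã₂}` (meaningful on members of `Ã₂`). -/
noncomputable def normT2 (𝒜₂ : SolidBanachAlgebra I₂) (A : Tensor I₁ I₂) : ℝ :=
  𝒜₂.anorm (fun k l : I₂ => (opNorm2 (res2 A k l) : ℂ))

/-- Membership in `𝒜 = Ã₁ ∩ Ã₂`. -/
def MemA (𝒜₁ : SolidBanachAlgebra I₁) (𝒜₂ : SolidBanachAlgebra I₂) (A : Tensor I₁ I₂) : Prop :=
  MemT1 𝒜₁.carrier A ∧ MemT2 𝒜₂.carrier A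

/-- The norm `‖A‖_𝒜 = max {‖A‖_{Ã₁}, ‖A‖_{Ã₂}}`. -/
noncomputable def normA (𝒜₁ : SolidBanachAlgebra I₁) (𝒜₂ : SolidBanachAlgebra I₂)
    (A : Tensor I₁ I₂) : ℝ :=
  max (normT1 𝒜₁ A) (normT2 𝒜₂ A)

/-- The matrix over `I₁ × I₂` through which a rank-four tensor acts on `ℓ²(I₁ × I₂)`:
`(Ac)_{(i,k)} = Σ_{(m,n)} A_{i,k,n,m} c_{(m,n)}`. -/
def toMatrix (A : Tensor I₁ I₂) : (I₁ × I₂) → (I₁ × I₂) → ℂ :=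
  fun p q => A p.1 p.2 q.2 q.1

/-- The rank-four tensor of matrix entries of an operator `T` on `ℓ²(I₁ × I₂)`:
its `(i,k,l,j)` entry is the `((i,k),(j,l))` matrix entry of `T`. -/
noncomputable def entryTensor (T : L2 (I₁ × I₂) →L[ℂ] L2 (I₁ × I₂)) : Tensor I₁ I₂ :=
  letI : DecidableEq (I₁ × I₂) := Classical.decEq _
  fun i k l j => (T (lp.single 2 (j, l) (1 : ℂ)) : ∀ _ : I₁ × I₂, ℂ) (i, k)

/-- A set `S` of rank-four tensors is inverse-closed if, whenever `A ∈ S` acts as a boundedly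
invertible operator on `ℓ²(I₁ × I₂)`, the rank-four tensor of matrix entries of the inverse
operator also belongs to `S`. -/
def InverseClosed (S : Set (Tensor I₁ I₂)) : Prop :=
  ∀ A ∈ S, ∀ T Tinv : L2 (I₁ × I₂) →L[ℂ] L2 (I₁ × I₂),
    Represents (toMatrix A) T →
    T.comp Tinv = ContinuousLinearMap.id ℂ (L2 (I₁ × I₂)) →
    Tinv.comp T = ContinuousLinearMap.id ℂ (L2 (I₁ × I₂)) →
    entryTensor Tinv ∈ S

/-- The doubly contracted tensor product
`(A : B)_{i,k,l,j} = Σ_{n ∈ I₂} Σ_{m ∈ I₁} A_{i,k,n,m} B_{m,n,l,j}`. -/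
noncomputable def contract (A B : Tensor I₁ I₂) : Tensor I₁ I₂ :=
  fun i k l j => ∑' n : I₂, ∑' m : I₁, A i k n m * B m n l j

/-- Absolute convergence of all series defining the doubly contracted tensor product. -/
def ContractSummable (A B : Tensor I₁ I₂) : Prop :=
  ∀ (i : I₁) (k l : I₂) (j : I₁),
    Summable (fun nm : I₂ × I₁ => ‖A i k nm.1 nm.2 * B nm.2 nm.1 l j‖)

/-- The adjoint tensor `(A*)_{i,k,l,j} = conj (A_{j,l,k,i})`. -/
def adjT (A : Tensor I₁ I₂) : Tensor I₁ I₂ := fun i k l j => conj (A j l k i)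


section MatrixOperators

open Classical in
lemma Represents.apply_single {M : I → I → ℂ} {T : L2 I →L[ℂ] L2 I} (h : Represents M T)
    (k l : I) : T (lp.single 2 l (1 : ℂ)) k = M k l := by
  refine (h (lp.single 2 l (1 : ℂ)) k).unique ?_
  convert hasSum_ite_eq l (M k l) using 2 with m
  by_cases hm : m = l
  · subst hm; simp
  · simp [hm]

open Classical in
lemma represents_of_apply_single {M : I → I → ℂ} {T : L2 I →L[ℂ] L2 I}
    (h : ∀ k l, T (lp.single 2 l (1 : ℂ)) k = M k l) : Represents M T := by
  intro c k
  have hc := (lp.hasSum_single (by simp) c).mapL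
    ((lp.evalCLM ℂ (fun _ : I => ℂ) 2 k).comp T)
  have hterm : ∀ l, M k l * c l = T (lp.single 2 l (c l)) k := fun l => by
    have hs : lp.single 2 l (c l) = c l • (lp.single 2 l (1 : ℂ) : L2 I) := by
      rw [← lp.single_smul, smul_eq_mul, mul_one]
    rw [hs, map_smul, ← h k l, mul_comm]
    rfl
  rw [funext hterm]
  exact hc

lemma Represents.unique {M : I → I → ℂ} {S T : L2 I →L[ℂ] L2 I} (hS : Represents M S)
    (hT : Represents M T) : S = T :=
  ContinuousLinearMap.ext fun c => lp.ext (funext fun k => (hS c k).unique (hT c k))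

lemma Represents.opNorm2_eq {M : I → I → ℂ} {T : L2 I →L[ℂ] L2 I} (h : Represents M T) :
    opNorm2 M = ‖T‖ := by
  have hM : Bounded2 M := ⟨T, h⟩
  rw [opNorm2, dif_pos hM, hM.choose_spec.unique h]

lemma opNorm2_nonneg (M : I → I → ℂ) : 0 ≤ opNorm2 M := by
  unfold opNorm2
  split_ifs
  · exact norm_nonneg _
  · exact le_rfl

lemma Bounded2.exists_col {M : I → I → ℂ} (h : Bounded2 M) (l : I) :
    ∃ v : L2 I, ‖v‖ ≤ opNorm2 M ∧ ∀ k, v k = M k l := by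
  classical
  obtain ⟨T, hT⟩ := h
  refine ⟨T (lp.single 2 l (1 : ℂ)), ?_, fun k => hT.apply_single k l⟩
  rw [hT.opNorm2_eq]
  simpa [lp.norm_single] using T.le_opNorm (lp.single 2 l (1 : ℂ))

lemma Bounded2.exists_row {M : I → I → ℂ} (h : Bounded2 M) (k : I) :
    ∃ v : L2 I, ‖v‖ ≤ opNorm2 M ∧ ∀ l, ‖v l‖ = ‖M k l‖ := by
  classical
  obtain ⟨T, hT⟩ := h
  refine ⟨T.adjoint (lp.single 2 k (1 : ℂ)), ?_, fun l => ?_⟩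
  · rw [hT.opNorm2_eq, ← ContinuousLinearMap.adjoint.norm_map T]
    simpa [lp.norm_single] using T.adjoint.le_opNorm (lp.single 2 k (1 : ℂ))
  · have key := T.adjoint_inner_left (lp.single 2 l (1 : ℂ)) (lp.single 2 k (1 : ℂ))
    rw [lp.inner_single_left, lp.inner_single_right, hT.apply_single] at key
    simpa using congrArg norm key

lemma Bounded2.summable_norm_mul {M N : I → I → ℂ} (hM : Bounded2 M) (hN : Bounded2 N)
    (k l : I) : (Summable fun n => ‖M k n * N n l‖) ∧
      ∑' n, ‖M k n * N n l‖ ≤ opNorm2 M * opNorm2 N := by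
  obtain ⟨u, hu, hu'⟩ := hM.exists_row k
  obtain ⟨v, hv, hv'⟩ := hN.exists_col l
  have hpq : (2 : ENNReal).toReal.HolderConjugate (2 : ENNReal).toReal := by
    simpa using Real.HolderConjugate.two_two
  have := lp.tsum_mul_le_mul_norm hpq u v
  simp only [hu', hv', ← norm_mul] at this
  exact ⟨this.1, this.2.trans (mul_le_mul hu hv (norm_nonneg _) (opNorm2_nonneg _))⟩

end MatrixOperators

section Contraction

variable {𝒜₁ : SolidBanachAlgebra I₁} {A B : Tensor I₁ I₂}

lemma MemT1.summable_opNorm2_mul (hA : MemT1 𝒜₁.carrier A) (hB : MemT1 𝒜₁.carrier B)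
    (i j : I₁) : Summable fun m => opNorm2 (res1 A i m) * opNorm2 (res1 B m j) := by
  have := ((𝒜₁.bounded _ hA.2).summable_norm_mul (𝒜₁.bounded _ hB.2) i j).1
  simpa [abs_of_nonneg (opNorm2_nonneg _)] using this

lemma MemT1.contractSummable (hA : MemT1 𝒜₁.carrier A) (hB : MemT1 𝒜₁.carrier B) :
    ContractSummable A B := by
  intro i k l j
  have hn := fun m => (hA.1 i m).summable_norm_mul (hB.1 m j) k l
  rw [← (Equiv.prodComm I₁ I₂).summable_iff]
  refine (summable_prod_of_nonneg fun _ => norm_nonneg _).2 ⟨fun m => (hn m).1, ?_⟩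
  exact (hA.summable_opNorm2_mul hB i j).of_nonneg_of_le
    (fun m => tsum_nonneg fun _ => norm_nonneg _) fun m => (hn m).2

lemma MemT1.exists_represents_contract (hA : MemT1 𝒜₁.carrier A) (hB : MemT1 𝒜₁.carrier B)
    (i j : I₁) : ∃ T : L2 I₂ →L[ℂ] L2 I₂, Represents (res1 (contract A B) i j) T ∧
      ‖T‖ ≤ ∑' m, opNorm2 (res1 A i m) * opNorm2 (res1 B m j) := by
  classical
  choose S hS using fun m => hA.1 i m
  choose R hR using fun m => hB.1 m j
  have hle : ∀ m, ‖(S m).comp (R m)‖ ≤ opNorm2 (res1 A i m) * opNorm2 (res1 B m j) := fun m => by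
    rw [(hS m).opNorm2_eq, (hR m).opNorm2_eq]
    exact (S m).opNorm_comp_le (R m)
  have hsum := hA.summable_opNorm2_mul hB i j
  have hT : Summable fun m => (S m).comp (R m) := .of_norm_bounded hsum hle
  refine ⟨∑' m, (S m).comp (R m), represents_of_apply_single fun k l => ?_,
    tsum_of_norm_bounded hsum.hasSum hle⟩
  have hentry : ∀ m, S m (R m (lp.single 2 l (1 : ℂ))) k = ∑' n, A i k n m * B m n l j := fun m => by
    rw [← (hS m (R m (lp.single 2 l (1 : ℂ))) k).tsum_eq]
    exact tsum_congr fun n => by rw [(hR m).apply_single]; rfl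
  have happly := hT.hasSum.mapL
    ((lp.evalCLM ℂ (fun _ : I₂ => ℂ) 2 k).comp
      (ContinuousLinearMap.apply ℂ (L2 I₂) (lp.single 2 l (1 : ℂ))))
  calc _ = ∑' m, S m (R m (lp.single 2 l (1 : ℂ))) k := happly.tsum_eq.symm
    _ = ∑' m, ∑' n, A i k n m * B m n l j := tsum_congr hentry
    _ = res1 (contract A B) i j k l :=
      (hA.contractSummable hB i k l j).of_norm.tsum_comm

end Contraction

/-- the doubly contracted product of two elements of `Ã₁` is well defined, lies in
`Ã₁`, and `‖A : B‖_Ã₁ ≤ ‖A‖_Ã₁ ‖B‖_Ã₁`. -/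
theorem statement10 {I₁ I₂ : Type*} [Countable I₁] [Countable I₂]
    (𝒜₁ : SolidBanachAlgebra I₁)
    (A B : Tensor I₁ I₂) (hA : MemT1 𝒜₁.carrier A) (hB : MemT1 𝒜₁.carrier B) :
    ContractSummable A B ∧ MemT1 𝒜₁.carrier (contract A B) ∧
      normT1 𝒜₁ (contract A B) ≤ normT1 𝒜₁ A * normT1 𝒜₁ B := by
  choose T hT hle using hA.exists_represents_contract hB
  have hsolid := 𝒜₁.solid _ (𝒜₁.mul_mem _ _ hA.2 hB.2)
    (fun i j => (opNorm2 (res1 (contract A B) i j) : ℂ)) fun i j => by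
      have hmul : matMul (fun i j => (opNorm2 (res1 A i j) : ℂ))
          (fun i j => (opNorm2 (res1 B i j) : ℂ)) i j =
          ((∑' m, opNorm2 (res1 A i m) * opNorm2 (res1 B m j) : ℝ) : ℂ) := by
        simp [matMul, Complex.ofReal_tsum]
      rw [hmul, Complex.norm_of_nonneg (opNorm2_nonneg _),
        Complex.norm_of_nonneg (tsum_nonneg fun m =>
          mul_nonneg (opNorm2_nonneg _) (opNorm2_nonneg _)), (hT i j).opNorm2_eq]
      exact hle i j
  exact ⟨hA.contractSummable hB, ⟨fun i j => ⟨T i j, hT i j⟩, hsolid.1⟩,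
    hsolid.2.trans (𝒜₁.anorm_mul _ hA.2 _ hB.2)⟩

end PaperTensor
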